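/- arXiv:1310.6384 — 2 statements merged into one kernel-verified Lean document; each statement's English description precedes it below -/
import Mathlib

section
/- Let G be a normal subgroup of a finite group H. For g₁, g₂ ∈ G that are conjugate in H, and with Q = H/G, the sum ∑_{[ρ] ∈ Ĝ} ∑_{q ∈ Q} χ_ρ(g₁⁻¹)·χ_{q([ρ])}(g₂) is a positive integer equal to |C_H(g₁)|; in particular, when H = G (so Q is trivial), this recovers the column orthogonality relation ∑_{[ρ]} χ_ρ(g₁⁻¹)χ_ρ(g₂) = |C_G(g₁)| for g₁ conjugate to g₂ in G. -/
open CategoryTheory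
open scoped MonoidAlgebra

theorem aux_irr {G V : Type} [Group G] [Fintype G] [AddCommGroup V] [Module ℂ V]
    [FiniteDimensional ℂ V] (ρ : Representation ℂ G V) [hρ : ρ.IsIrreducible]
    (f : G → ℂ) (hf : ∀ x g, f (x * g * x⁻¹) = f g)
    (h0 : ∑ g, f g * ρ.character g = 0) : ∑ g, f g • ρ g = 0 := by
  let T : Representation.IntertwiningMap ρ ρ := ⟨∑ g, f g • ρ g, fun x => by
    simp only [← Module.End.mul_eq_comp, Finset.sum_mul, Finset.mul_sum, smul_mul_assoc,
      mul_smul_comm, ← map_mul]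
    refine Fintype.sum_bijective (fun g => x⁻¹ * g * x) ?_ _ _ ?_
    · exact (MulAut.conj x⁻¹).bijective.comp Function.bijective_id |> fun h => by
        convert h using 2; simp
    · intro g
      have := hf x⁻¹ g
      rw [inv_inv] at this
      rw [this]; congr 2; group⟩
  obtain ⟨c, hc⟩ := (Representation.IsIrreducible.algebraMap_intertwiningMap_bijective_of_isAlgClosed
    (ρ := ρ)).2 T
  have hT : ∑ g, f g • ρ g = c • (LinearMap.id : V →ₗ[ℂ] V) := by
    have := congrArg (fun S => S.toLinearMap) hc
    exact this.symm
  have htr := congrArg (LinearMap.trace ℂ V) hT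
  have hnt : Nontrivial V := by
    by_contra hV
    rw [not_nontrivial_iff_subsingleton] at hV
    obtain ⟨a, b, hab⟩ := hρ.exists_pair_ne
    apply hab
    ext v
    rw [Subsingleton.elim v 0]
    exact iff_of_true a.toSubmodule.zero_mem b.toSubmodule.zero_mem
  have hd : (Module.finrank ℂ V : ℂ) ≠ 0 := by
    exact_mod_cast (Module.finrank_pos (R := ℂ) (M := V)).ne'
  simp only [map_sum, map_smul, LinearMap.trace_id, smul_eq_mul] at htr
  have : c = 0 := by
    have h1 : c * (Module.finrank ℂ V : ℂ) = 0 := by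
      rw [← htr]; exact h0
    exact (mul_eq_zero.mp h1).resolve_right hd
  rw [hT, this, zero_smul]

theorem aux_simple {G V : Type} [Group G] [Fintype G] [AddCommGroup V] [Module ℂ V]
    [FiniteDimensional ℂ V] (ρ : Representation ℂ G V) [hρ : ρ.IsIrreducible] :
    Simple (FDRep.of ρ) := by
  classical
  have := invertibleOfNonzero (NeZero.ne (Nat.card G : ℂ))
  rw [FDRep.simple_iff_char_is_norm_one]
  have h := Representation.char_orthonormal ρ ρ
  rw [if_pos ⟨Representation.Equiv.refl ρ⟩, inv_mul_eq_one₀ (NeZero.ne (Nat.card G : ℂ))] at h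
  exact h.symm

theorem aux_module {G : Type} [Group G] [Fintype G] (f : G → ℂ)
    (hf : ∀ x g, f (x * g * x⁻¹) = f g)
    (h0 : ∀ W : FDRep ℂ G, Simple W → ∑ g, f g * W.character g = 0)
    (M : Type) [AddCommGroup M] [Module ℂ M] [Module ℂ[G] M] [IsScalarTower ℂ ℂ[G] M]
    [hs : IsSimpleModule ℂ[G] M] (v : M) :
    (∑ g, f g • MonoidAlgebra.single g 1 : ℂ[G]) • v = 0 := by
  let ρ : Representation ℂ G M :=
    ((Algebra.lsmul ℂ ℂ M : ℂ[G] →ₐ[ℂ] Module.End ℂ M) : ℂ[G] →* Module.End ℂ M).comp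
      (MonoidAlgebra.of ℂ G)
  have hρ : ∀ g w, ρ g w = (MonoidAlgebra.single g 1 : ℂ[G]) • w := fun g w => rfl
  have hM : Nontrivial M := IsSimpleModule.nontrivial ℂ[G] M
  have hirr : ρ.IsIrreducible := by
    refine { exists_pair_ne := ⟨⊥, ⊤, fun h => ?_⟩, eq_bot_or_eq_top := fun σ => ?_ }
    · obtain ⟨w, hw⟩ := exists_ne (0 : M)
      have h1 : w ∈ (⊤ : Subrepresentation ρ).toSubmodule := Submodule.mem_top
      rw [← h] at h1
      exact hw ((Submodule.mem_bot ℂ).mp h1)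
    · let N : Submodule ℂ[G] M :=
        { σ.toSubmodule.toAddSubmonoid with
          smul_mem' := fun a w hw => by
            change a • w ∈ σ.toSubmodule
            change w ∈ σ.toSubmodule at hw
            induction a using MonoidAlgebra.induction_on with
            | of g => exact σ.apply_mem_toSubmodule g hw
            | add a b ha hb => rw [add_smul]; exact add_mem ha hb
            | smul r a ha => rw [smul_assoc]; exact σ.toSubmodule.smul_mem r ha }
      have hmem : ∀ w, w ∈ N ↔ w ∈ σ.toSubmodule := fun w => Iff.rfl
      rcases eq_bot_or_eq_top N with h | h
      · left
        ext w
        change w ∈ σ.toSubmodule ↔ w ∈ (⊥ : Submodule ℂ M)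
        rw [← hmem, h, Submodule.mem_bot, Submodule.mem_bot]
      · right
        ext w
        change w ∈ σ.toSubmodule ↔ w ∈ (⊤ : Submodule ℂ M)
        rw [← hmem, h]
        exact iff_of_true Submodule.mem_top Submodule.mem_top
  have hfd : FiniteDimensional ℂ M := Module.Finite.trans ℂ[G] M
  have h1 := aux_irr ρ f hf (h0 _ (aux_simple ρ))
  have h2 := LinearMap.congr_fun h1 v
  simp only [LinearMap.sum_apply, LinearMap.smul_apply, LinearMap.zero_apply, hρ] at h2
  rw [Finset.sum_smul, ← h2]
  exact Finset.sum_congr rfl fun g _ => smul_assoc _ _ _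

theorem aux_complete {G : Type} [Group G] [Fintype G] (f : G → ℂ)
    (hf : ∀ x g, f (x * g * x⁻¹) = f g)
    (h0 : ∀ W : FDRep ℂ G, Simple W → ∑ g, f g * W.character g = 0) : f = 0 := by
  have : NeZero (Nat.card G : ℂ) := inferInstance
  let z : ℂ[G] := ∑ g, f g • MonoidAlgebra.single g 1
  have hz : z ∈ Ring.jacobson ℂ[G] := by
    rw [Ring.jacobson, Module.jacobson, Submodule.mem_sInf]
    intro m hm
    have hs : IsSimpleModule ℂ[G] (ℂ[G] ⧸ m) := isSimpleModule_iff_isCoatom.mpr hm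
    have h2 := aux_module f hf h0 (ℂ[G] ⧸ m) (Submodule.Quotient.mk 1)
    rw [← Submodule.Quotient.mk_smul, smul_eq_mul, mul_one, Submodule.Quotient.mk_eq_zero] at h2
    exact h2
  rw [IsSemisimpleRing.jacobson_eq_bot, Submodule.mem_bot] at hz
  funext g
  have := congrArg (fun w : ℂ[G] => w.coeff g) hz
  classical
  simpa [z, Finsupp.single_apply] using this

theorem aux_col {G : Type} [Group G] [Fintype G] [DecidableEq G]
    {ι : Type} [Fintype ι] (ρ : ι → FDRep ℂ G)
    (hsimple : ∀ i, Simple (ρ i))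
    (hdistinct : ∀ i i', i ≠ i' → IsEmpty (ρ i ≅ ρ i'))
    (hcomplete : ∀ W : FDRep ℂ G, Simple W → ∃ i, Nonempty (W ≅ ρ i)) (a b : G) :
    ∑ i, (ρ i).character a⁻¹ * (ρ i).character b = ∑ x : G, if x * a * x⁻¹ = b then 1 else 0 := by
  classical
  have := invertibleOfNonzero (NeZero.ne (Nat.card G : ℂ))
  let f : G → ℂ := fun g => ∑ i, (ρ i).character a⁻¹ * (ρ i).character g⁻¹ -
    ∑ x : G, if x * a * x⁻¹ = g⁻¹ then 1 else 0
  have hf : f = 0 := by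
    apply aux_complete
    · intro x g
      simp only [f]
      congr 1
      · refine Finset.sum_congr rfl fun i _ => ?_
        rw [show (x * g * x⁻¹)⁻¹ = x * g⁻¹ * x⁻¹ by group, FDRep.char_conj]
      · refine Fintype.sum_bijective (fun y => x⁻¹ * y) (Group.mulLeft_bijective _) _ _ ?_
        intro y
        refine if_congr ?_ rfl rfl
        constructor
        · intro h
          calc _ = x⁻¹ * (y * a * y⁻¹) * x := by group
            _ = _ := by rw [h]; group
        · intro h
          calc _ = x * (x⁻¹ * y * a * (x⁻¹ * y)⁻¹) * x⁻¹ := by group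
            _ = _ := by rw [h]; group
    · intro W hW
      obtain ⟨j, ⟨e⟩⟩ := hcomplete W hW
      rw [FDRep.char_iso e]
      simp only [f, sub_mul, Finset.sum_sub_distrib, Finset.sum_mul]
      rw [Finset.sum_comm, Finset.sum_comm (s := Finset.univ (α := G)), sub_eq_zero]
      have h1 : ∀ i, ∑ g, (ρ i).character a⁻¹ * (ρ i).character g⁻¹ * (ρ j).character g =
          if i = j then Nat.card G * (ρ j).character a⁻¹ else 0 := by
        intro i
        have := hsimple i
        have := hsimple j
        have h := FDRep.char_orthonormal (ρ j) (ρ i)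
        rw [inv_mul_eq_iff_eq_mul₀ (NeZero.ne (Nat.card G : ℂ))] at h
        calc _ = (ρ i).character a⁻¹ * ∑ g, (ρ j).character g * (ρ i).character g⁻¹ := by
              rw [Finset.mul_sum]; refine Finset.sum_congr rfl fun _ _ => by ring
          _ = _ := by
              rw [h]
              by_cases hij : i = j
              · subst hij
                rw [if_pos ⟨Iso.refl _⟩]; simp [mul_comm]
              · rw [if_neg (fun hn => (hdistinct j i (Ne.symm hij)).elim hn.some)]; simp [hij]
      have h2 : ∀ x : G, ∑ g, (if x * a * x⁻¹ = g⁻¹ then (1:ℂ) else 0) * (ρ j).character g =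
          (ρ j).character a⁻¹ := by
        intro x
        rw [Finset.sum_eq_single (x * a⁻¹ * x⁻¹)]
        · rw [if_pos (by group), one_mul, FDRep.char_conj]
        · intro g _ hg
          rw [if_neg, zero_mul]
          intro h; apply hg
          rw [← inv_inv g, ← h]; group
        · simp
      simp only [h1, h2]
      simp
  have := congrFun hf b⁻¹
  simpa [f, sub_eq_zero] using this

open scoped Classical in
theorem generalized_orthogonality_conjugate_case
    {H : Type} [Group H] [Fintype H]
    (G : Subgroup H) (hN : G.Normal)
    (s : H ⧸ G → H) (hs : ∀ q, QuotientGroup.mk' G (s q) = q)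
    {ι : Type} [Fintype ι] (ρ : ι → FDRep ℂ ↥G)
    (hsimple : ∀ i, Simple (ρ i))
    (hdistinct : ∀ i i', i ≠ i' → IsEmpty (ρ i ≅ ρ i'))
    (hcomplete : ∀ W : FDRep ℂ ↥G, Simple W → ∃ i, Nonempty (W ≅ ρ i))
    (g₁ g₂ : ↥G) (hconj : IsConj (g₁ : H) (g₂ : H)) :
    (∑ i : ι, ∑ q : H ⧸ G,
        (ρ i).character g₁⁻¹ *
          (ρ i).character ⟨s q * ↑g₂ * (s q)⁻¹, hN.conj_mem ↑g₂ g₂.2 (s q)⟩) =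
      (Fintype.card (Subgroup.centralizer ({(g₁ : H)} : Set H)) : ℂ) ∧
    0 < Fintype.card (Subgroup.centralizer ({(g₁ : H)} : Set H)) := by
  refine ⟨?_, Fintype.card_pos⟩
  rw [Finset.sum_comm]
  simp only [aux_col ρ hsimple hdistinct hcomplete]
  obtain ⟨c, hc⟩ := isConj_iff.mp hconj
  rw [← Fintype.sum_prod_type']
  have hs' : ∀ q, ((s q : H) : H ⧸ G) = q := hs
  have hbij : Function.Bijective (fun p : (H ⧸ G) × G => c⁻¹ * ((s p.1)⁻¹ * (p.2 : H))) := by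
    refine (Group.mulLeft_bijective c⁻¹).comp ?_
    constructor
    · rintro ⟨q, x⟩ ⟨q', x'⟩ h
      simp only at h
      have hq : q = q' := by
        have h3 := congrArg (QuotientGroup.mk' G) h
        have hx : ∀ x : G, QuotientGroup.mk' G (x : H) = 1 := fun x =>
          (QuotientGroup.eq_one_iff _).mpr x.2
        simp only [map_mul, map_inv, hs, hx, mul_one, inv_inj] at h3
        exact h3
      subst hq
      simpa using h
    · intro h
      refine ⟨⟨(h⁻¹ : H), ⟨s (h⁻¹ : H) * h, ?_⟩⟩, by simp⟩
      rw [← QuotientGroup.eq_one_iff, QuotientGroup.mk_mul, hs']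
      simp
  rw [Fintype.sum_bijective _ hbij _
    (fun h : H => if h ∈ Subgroup.centralizer ({(g₁ : H)} : Set H) then (1:ℂ) else 0)]
  · rw [Finset.sum_boole, Fintype.card_subtype]
  · rintro ⟨q, x⟩
    refine if_congr ?_ rfl rfl
    rw [Subgroup.mem_centralizer_singleton_iff, Subtype.ext_iff]
    simp only [Subgroup.coe_mul, Subgroup.coe_inv, ← hc]
    rw [mul_inv_eq_iff_eq_mul]
    simp only [mul_assoc, inv_mul_eq_iff_eq_mul]
end

section
/- Let H = G ⋊ Q be a semidirect product of finite groups with G abelian. For q ∈ Q, let C(q) ⊆ Q be the centralizer of q, let Ĝ be the character group of G, with Q acting on Ĝ by (q·χ)(g) = χ(q g q⁻¹), and let Ĝ^q ⊆ Ĝ be the set of characters fixed by q. Then the number of conjugacy classes of H mapping onto the conjugacy class ⟨q⟩ of Q under the projection j: H → Q equals the number of C(q)-orbits in Ĝ^q. -/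
namespace ConjCount

/-- the homomorphism a ↦ a / f a -/
def D {A : Type*} [CommGroup A] (f : A →* A) : A →* A := MonoidHom.id A / f

lemma D_apply {A : Type*} [CommGroup A] (f : A →* A) (a : A) : D f a = a / f a := rfl

/-- f-invariant characters are the characters of the coinvariants. -/
def charEquiv {A : Type*} [CommGroup A] (f : A →* A) :
    {χ : A →* ℂˣ // ∀ a, χ (f a) = χ a} ≃ ((A ⧸ (D f).range) →* ℂˣ) where
  toFun χ := QuotientGroup.lift _ χ.1 (by
    rintro _ ⟨a, rfl⟩
    simp [D_apply, χ.2 a])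
  invFun ψ := ⟨ψ.comp (QuotientGroup.mk' _), fun a => by
    simp only [MonoidHom.comp_apply, QuotientGroup.mk'_apply]
    congr 1
    rw [QuotientGroup.eq]
    exact ⟨a, by rw [D_apply, div_eq_mul_inv, mul_comm]⟩⟩
  left_inv χ := by ext; rfl
  right_inv ψ := by ext; rfl

lemma card_dual (A : Type*) [CommGroup A] [Finite A] : Nat.card (A →* ℂˣ) = Nat.card A := by
  have : HasEnoughRootsOfUnity ℂ (Monoid.exponent A) := inferInstance
  exact CommGroup.card_monoidHom_of_hasEnoughRootsOfUnity A ℂ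

lemma card_fixed {A : Type*} [CommGroup A] [Finite A] (f : A →* A) :
    Nat.card {χ : A →* ℂˣ // ∀ a, χ (f a) = χ a} = Nat.card {a : A // f a = a} := by
  rw [Nat.card_congr (charEquiv f), card_dual]
  have e : Nat.card {a : A // f a = a} = Nat.card (D f).ker :=
    Nat.card_congr (Equiv.subtypeEquivRight fun a => by
      rw [MonoidHom.mem_ker, D_apply, div_eq_one, eq_comm])
  rw [e]
  have h1 := (D f).ker.card_mul_index
  have h2 := (D f).range.card_mul_index
  rw [Subgroup.index_ker] at h1
  have h3 : 0 < Nat.card (D f).range := Nat.card_pos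
  change (D f).range.index = _
  have : Nat.card (D f).range * (D f).range.index
      = Nat.card (D f).range * Nat.card (D f).ker := by rw [h2, ← h1, mul_comm]
  exact Nat.eq_of_mul_eq_mul_left h3 this

/-- dual action -/
@[reducible] def dualAction (C A : Type*) [Group C] [CommGroup A] [MulDistribMulAction C A] :
    MulAction C (A →* ℂˣ) where
  smul z χ := χ.comp (MulDistribMulAction.toMonoidHom A z⁻¹)
  one_smul χ := by
    ext a
    change ((χ ((1 : C)⁻¹ • a) : ℂˣ) : ℂ) = _
    simp
  mul_smul x y χ := by
    ext a
    change ((χ ((x * y)⁻¹ • a) : ℂˣ) : ℂ) = ((χ (y⁻¹ • x⁻¹ • a) : ℂˣ) : ℂ)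
    rw [mul_inv_rev, mul_smul]

lemma card_of_surj {X Y Z : Type*} (f : X → Y) (g : X → Z) (hf : Function.Surjective f)
    (hg : Function.Surjective g) (h : ∀ a b, f a = f b ↔ g a = g b) : Nat.card Y = Nat.card Z := by
  have e : Setoid.ker f = Setoid.ker g := by
    ext a b
    exact h a b
  rw [← Nat.card_congr (Setoid.quotientKerEquivOfSurjective f hf),
    ← Nat.card_congr (Setoid.quotientKerEquivOfSurjective g hg), e]

lemma burnside {C X Y : Type*} [Group C] [Finite C] [MulAction C X] [MulAction C Y] [Finite X]
    [Finite Y] (h : ∀ z : C, Nat.card (MulAction.fixedBy X z) = Nat.card (MulAction.fixedBy Y z)) :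
    Nat.card (MulAction.orbitRel.Quotient C X) = Nat.card (MulAction.orbitRel.Quotient C Y) := by
  classical
  have := Fintype.ofFinite C
  have := Fintype.ofFinite X
  have := Fintype.ofFinite Y
  have := Fintype.ofFinite (MulAction.orbitRel.Quotient C X)
  have := Fintype.ofFinite (MulAction.orbitRel.Quotient C Y)
  have hx := MulAction.sum_card_fixedBy_eq_card_orbits_mul_card_group C X
  have hy := MulAction.sum_card_fixedBy_eq_card_orbits_mul_card_group C Y
  simp only [← Nat.card_eq_fintype_card] at hx hy
  rw [Finset.sum_congr rfl (fun z _ => h z), hy] at hx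
  exact (Nat.eq_of_mul_eq_mul_right Nat.card_pos hx).symm

lemma card_orbits (C A : Type*) [Group C] [Finite C] [CommGroup A] [Finite A]
    [MulDistribMulAction C A] :
    letI := dualAction C A
    Nat.card (MulAction.orbitRel.Quotient C A) =
      Nat.card (MulAction.orbitRel.Quotient C (A →* ℂˣ)) := by
  let := dualAction C A
  have : Finite (A →* ℂˣ) := by
    apply Nat.finite_of_card_ne_zero
    rw [card_dual]
    exact Nat.card_pos.ne'
  apply burnside
  intro z
  have h := card_fixed (MulDistribMulAction.toMonoidHom A z⁻¹)
  have e1 : Nat.card (MulAction.fixedBy A z) =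
      Nat.card {a : A // MulDistribMulAction.toMonoidHom A z⁻¹ a = a} :=
    Nat.card_congr (Equiv.subtypeEquivRight fun a => by
      rw [MulAction.mem_fixedBy, MulDistribMulAction.toMonoidHom_apply, inv_smul_eq_iff, eq_comm])
  rw [e1, ← h]
  exact Nat.card_congr (Equiv.subtypeEquivRight fun χ => by
    rw [MulAction.mem_fixedBy]
    exact (DFunLike.ext_iff (F := A →* ℂˣ)
      (f := χ.comp (MulDistribMulAction.toMonoidHom A z⁻¹)) (g := χ)).symm)

/-- action of the centralizer on coinvariants -/
@[reducible] def coinvAction {G Q : Type*} [CommGroup G] [Group Q] (φ : Q →* MulAut G) (q : Q) :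
    MulDistribMulAction (Subgroup.centralizer ({q} : Set Q))
      (G ⧸ (D (φ q).toMonoidHom).range) where
  smul z := QuotientGroup.map _ _ (φ z.1).toMonoidHom (by
    rintro _ ⟨a, rfl⟩
    refine ⟨φ z.1 a, ?_⟩
    have hz : q * z.1 = z.1 * q := Subgroup.mem_centralizer_singleton_iff.1 z.2 |>.symm
    have : φ q (φ z.1 a) = φ z.1 (φ q a) := by
      rw [← MulAut.mul_apply, ← MulAut.mul_apply, ← map_mul, ← map_mul, hz]
    simp [D_apply, this])
  one_smul a := by
    induction a using QuotientGroup.induction_on with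
    | H a =>
      change ((φ 1 a : G) : G ⧸ (D (φ q).toMonoidHom).range) = _
      simp
  mul_smul x y a := by
    induction a using QuotientGroup.induction_on with
    | H a =>
      change ((φ (x.1 * y.1) a : G) : G ⧸ (D (φ q).toMonoidHom).range) = ((φ x.1 (φ y.1 a) : G) : _)
      simp
  smul_mul x a b := map_mul _ a b
  smul_one x := map_one _

lemma conj_left {G Q : Type*} [CommGroup G] [Group Q] (φ : Q →* MulAut G) {q z : Q}
    (hz : z * q = q * z) (g b : G) :
    ((⟨g, z⟩ : G ⋊[φ] Q) * ⟨b, q⟩ * (⟨g, z⟩ : G ⋊[φ] Q)⁻¹).left = g * φ z b * (φ q g)⁻¹ := by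
  rw [SemidirectProduct.mul_left, SemidirectProduct.mul_left, SemidirectProduct.mul_right,
    SemidirectProduct.inv_left]
  simp only [hz]
  simp

end ConjCount

open ConjCount in
theorem conjugacy_count_semidirect_abelian
    {G Q : Type*} [CommGroup G] [Group Q] [Fintype G] [Fintype Q]
    (φ : Q →* MulAut G) (q : Q) :
    Nat.card {c : ConjClasses (G ⋊[φ] Q) //
        ConjClasses.map (SemidirectProduct.rightHom : G ⋊[φ] Q →* Q) c =
          ConjClasses.mk q} =
      Nat.card (Quot (fun (χ χ' : {χ : G →* ℂˣ // ∀ g : G, χ (φ q g) = χ g}) =>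
        ∃ z ∈ Subgroup.centralizer ({q} : Set Q),
          ∀ g : G, (χ' : G →* ℂˣ) g = (χ : G →* ℂˣ) (φ z g))) := by
  let i1 := coinvAction φ q
  let i2 := dualAction (Subgroup.centralizer ({q} : Set Q)) (G ⧸ (D (φ q).toMonoidHom).range)
  have key := card_orbits (Subgroup.centralizer ({q} : Set Q)) (G ⧸ (D (φ q).toMonoidHom).range)
  refine Eq.trans ?_ (key.trans ?_)
  · refine card_of_surj (X := G) (fun g => ⟨ConjClasses.mk ⟨g, q⟩, by exact rfl⟩)
      (fun g => Quotient.mk _ (g : G ⧸ (D (φ q).toMonoidHom).range)) ?_ ?_ ?_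
    · rintro ⟨c, hc⟩
      induction c using Quotient.inductionOn with
      | h c =>
      have hc' : IsConj c.right q := ConjClasses.mk_eq_mk_iff_isConj.1 hc
      obtain ⟨x, hx⟩ := isConj_iff.1 hc'
      refine ⟨φ x c.left, Subtype.ext ?_⟩
      refine ConjClasses.mk_eq_mk_iff_isConj.2 (IsConj.symm ?_)
      refine isConj_iff.2 ⟨SemidirectProduct.inr x, ?_⟩
      ext
      · simp
      · simpa using hx
    · intro y
      induction y using Quotient.inductionOn with
      | h y =>
      obtain ⟨g, rfl⟩ := QuotientGroup.mk_surjective y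
      exact ⟨g, rfl⟩
    · intro a b
      rw [Subtype.ext_iff, ConjClasses.mk_eq_mk_iff_isConj, isConj_comm, isConj_iff, Quotient.eq,
        MulAction.orbitRel_apply]
      constructor
      · rintro ⟨⟨g, z⟩, h⟩
        have hr := congrArg SemidirectProduct.right h
        have hl := congrArg SemidirectProduct.left h
        change z * q * z⁻¹ = q at hr
        have hz : z * q = q * z := mul_inv_eq_iff_eq_mul.1 hr
        refine ⟨⟨z, Subgroup.mem_centralizer_singleton_iff.2 hz⟩, ?_⟩
        change ((φ z b : G) : G ⧸ (D (φ q).toMonoidHom).range) = (a : _)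
        rw [QuotientGroup.eq]
        refine ⟨g, ?_⟩
        rw [conj_left φ hz] at hl
        change g / φ q g = _
        change _ = a at hl
        rw [← hl]
        rw [mul_assoc, mul_left_comm g, inv_mul_cancel_left, div_eq_mul_inv]
      · rintro ⟨⟨z, hz⟩, h⟩
        have hz' : z * q = q * z := Subgroup.mem_centralizer_singleton_iff.1 hz
        change ((φ z b : G) : G ⧸ (D (φ q).toMonoidHom).range) = (a : _) at h
        rw [QuotientGroup.eq] at h
        obtain ⟨g, hg⟩ := h
        refine ⟨⟨g, z⟩, ?_⟩
        have hr : z * q * z⁻¹ = q := mul_inv_eq_iff_eq_mul.2 hz'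
        refine SemidirectProduct.ext ?_ hr
        rw [conj_left φ hz']
        change g / φ q g = _ at hg
        change _ = a
        rw [← mul_inv_cancel_left (φ z b) a, ← hg]
        rw [div_eq_mul_inv, mul_assoc, mul_left_comm]
  · refine card_of_surj (X := {χ : G →* ℂˣ // ∀ g : G, χ (φ q g) = χ g})
      (fun χ => Quotient.mk _ (charEquiv (φ q).toMonoidHom χ)) (fun χ => Quot.mk _ χ) ?_
      Quot.mk_surjective ?_
    · exact Quotient.mk_surjective.comp (charEquiv (φ q).toMonoidHom).surjective
    · intro a b
      rw [Quotient.eq, MulAction.orbitRel_apply, Equivalence.quot_mk_eq_iff]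
      · constructor
        · rintro ⟨⟨z, hz⟩, h⟩
          refine ⟨z, hz, fun g => ?_⟩
          have := DFunLike.congr_fun h ((φ z g : G) : G ⧸ (D (φ q).toMonoidHom).range)
          change b.1 (φ z⁻¹ (φ z g)) = a.1 (φ z g) at this
          rw [← this]
          simp
        · rintro ⟨z, hz, h⟩
          refine ⟨⟨z, hz⟩, ?_⟩
          ext g
          change ((b.1 (φ z⁻¹ g) : ℂˣ) : ℂ) = a.1 g
          rw [h]
          simp
      · refine ⟨fun χ => ⟨1, one_mem _, fun g => by simp⟩, ?_, ?_⟩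
        · rintro x y ⟨z, hz, h⟩
          exact ⟨z⁻¹, inv_mem hz, fun g => by simp [h]⟩
        · rintro x y w ⟨z, hz, h⟩ ⟨z', hz', h'⟩
          exact ⟨z * z', mul_mem hz hz', fun g => by simp [h, h']⟩
end
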